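/- Let d ≥ 1, let I = I_1 × ⋯ × I_d ⊂ ℝ^d be a product of bounded intervals, let c₀ > 0, and let (ξ_k)_{k∈ℤ^d} ⊂ ℝ^d be frequencies satisfying |ξ_{k,i} − ξ_{l,i}| ≥ c₀ |k_i − l_i| / |I_i| for all i = 1, …, d and all k, l ∈ ℤ^d. Then there is a constant C = C(c₀, d) such that for every finitely supported family of complex coefficients (c_k)_{k∈ℤ^d} one has ‖ ∑_{k∈ℤ^d} c_k e(ξ_k · y) ‖_{L²_y(I)} ≤ C |I|^{1/2} (∑_k |c_k|²)^{1/2}, where |I| = |I_1|⋯|I_d| is the Lebesgue measure of I. -/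

import Mathlib

open MeasureTheory ENNReal
open scoped NNReal

/-- `e(x) = exp(2πix)`. -/
noncomputable def ce (x : ℝ) : ℂ := Complex.exp (Complex.I * (2 * Real.pi * x))

/-- The Gaussian of width `L` centred at `m`, modulated to frequency `η`. -/
noncomputable def modulatedGaussian (m L η y : ℝ) : ℂ :=
  Complex.exp (-(Real.pi / L ^ 2 : ℂ) * (y : ℂ) ^ 2 +
    (2 * Real.pi * m / L ^ 2 + 2 * Real.pi * Complex.I * η : ℂ) * y + -(Real.pi * m ^ 2 / L ^ 2 : ℂ))

lemma neg_pi_div_sq_re_neg {L : ℝ} (hL : 0 < L) : (-(Real.pi / L ^ 2 : ℂ)).re < 0 := by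
  have h : (-(Real.pi / L ^ 2 : ℂ)) = ((-(Real.pi / L ^ 2) : ℝ) : ℂ) := by push_cast; ring
  rw [h, Complex.ofReal_re]
  have := Real.pi_pos
  have : 0 < Real.pi / L ^ 2 := by positivity
  linarith

lemma integrable_modulatedGaussian (m η : ℝ) {L : ℝ} (hL : 0 < L) :
    Integrable (modulatedGaussian m L η) :=
  integrable_cexp_quadratic' (neg_pi_div_sq_re_neg hL) _ _

lemma norm_integral_modulatedGaussian (m η : ℝ) {L : ℝ} (hL : 0 < L) :
    ‖∫ y, modulatedGaussian m L η y‖ = L * Real.exp (-Real.pi * (L * η) ^ 2) := by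
  have hLc : (L : ℂ) ≠ 0 := by exact_mod_cast hL.ne'
  have hpi : (Real.pi : ℂ) ≠ 0 := by exact_mod_cast Real.pi_ne_zero
  unfold modulatedGaussian
  rw [integral_cexp_quadratic (neg_pi_div_sq_re_neg hL), norm_mul]
  congr 1
  · have h : (Real.pi : ℂ) / -(-(Real.pi / L ^ 2 : ℂ)) = ((L ^ 2 : ℝ) : ℂ) := by
      push_cast; field_simp
    rw [h, Complex.norm_cpow_eq_rpow_re_of_pos (by positivity)]
    norm_num
    rw [← Real.sqrt_eq_rpow, Real.sqrt_sq hL.le]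
  · rw [Complex.norm_exp]
    congr 1
    have h : -(Real.pi * m ^ 2 / L ^ 2 : ℂ) -
        (2 * Real.pi * m / L ^ 2 + 2 * Real.pi * Complex.I * η : ℂ) ^ 2 /
          (4 * -(Real.pi / L ^ 2 : ℂ)) =
        ((-Real.pi * (L * η) ^ 2 : ℝ) : ℂ) + ((2 * Real.pi * m * η : ℝ) : ℂ) * Complex.I := by
      push_cast
      field_simp
      linear_combination (4 * η ^ 2 * L ^ 4 : ℂ) * Complex.I_sq
    rw [h, Complex.add_re, Complex.re_ofReal_mul, Complex.I_re, mul_zero, add_zero,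
      Complex.ofReal_re]

lemma modulatedGaussian_eq (m L η y : ℝ) :
    modulatedGaussian m L η y = ce (η * y) * (Real.exp (-Real.pi * ((y - m) / L) ^ 2) : ℝ) := by
  unfold modulatedGaussian ce
  rw [Complex.ofReal_exp, ← Complex.exp_add]
  congr 1
  push_cast
  ring

lemma ce_sum {ι : Type*} (s : Finset ι) (f : ι → ℝ) : ce (∑ i ∈ s, f i) = ∏ i ∈ s, ce (f i) := by
  simp only [ce, Complex.ofReal_sum, Finset.mul_sum, Complex.exp_sum]

lemma ce_sub (x y : ℝ) : ce (x - y) = ce x * (starRingEnd ℂ) (ce y) := by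
  simp only [ce, ← Complex.exp_conj, ← Complex.exp_add, map_mul, Complex.conj_I,
    Complex.conj_ofReal, map_ofNat]
  congr 1
  push_cast
  ring

lemma prod_modulatedGaussian {d : ℕ} (m L ξ η y : Fin d → ℝ) :
    ∏ i, modulatedGaussian (m i) (L i) (ξ i - η i) (y i) =
      ce (∑ i, ξ i * y i) * (starRingEnd ℂ) (ce (∑ i, η i * y i)) *
        ((∏ i, Real.exp (-Real.pi * ((y i - m i) / L i) ^ 2) : ℝ) : ℂ) := by
  simp only [modulatedGaussian_eq]
  rw [Finset.prod_mul_distrib, ← ce_sum, ← ce_sub, ← Finset.sum_sub_distrib, Complex.ofReal_prod]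
  simp only [sub_mul]

lemma norm_integral_prod_modulatedGaussian {d : ℕ} (m η : Fin d → ℝ) {L : Fin d → ℝ}
    (hL : ∀ i, 0 < L i) :
    ‖∫ y : Fin d → ℝ, ∏ i, modulatedGaussian (m i) (L i) (η i) (y i)‖ =
      (∏ i, L i) * ∏ i, Real.exp (-Real.pi * (L i * η i) ^ 2) := by
  rw [integral_fintype_prod_volume_eq_prod (fun i => modulatedGaussian (m i) (L i) (η i)),
    norm_prod, ← Finset.prod_mul_distrib]
  exact Finset.prod_congr rfl fun i _ => norm_integral_modulatedGaussian _ _ (hL i)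

lemma summable_exp_neg_pi_mul_sq {c : ℝ} (hc : 0 < c) :
    Summable fun n : ℤ => Real.exp (-Real.pi * (c * n) ^ 2) := by
  convert summable_pow_mul_jacobiTheta₂_term_bound 0 (pow_pos hc 2) 0 using 2 with n
  simp [mul_pow]

lemma sum_prod_le_tsum_pow {d : ℕ} {g : ℤ → ℝ} (hg : Summable g) (hg0 : ∀ n, 0 ≤ g n)
    (S : Finset (Fin d → ℤ)) (k : Fin d → ℤ) :
    ∑ l ∈ S, ∏ i, g (k i - l i) ≤ (∑' n, g n) ^ d := by
  classical
  let t : Fin d → Finset ℤ := fun i => S.image fun l => l i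
  have hS : S ⊆ Fintype.piFinset t := fun l hl =>
    Fintype.mem_piFinset.2 fun i => Finset.mem_image_of_mem (fun l : Fin d → ℤ => l i) hl
  calc ∑ l ∈ S, ∏ i, g (k i - l i) ≤ ∑ l ∈ Fintype.piFinset t, ∏ i, g (k i - l i) :=
        Finset.sum_le_sum_of_subset_of_nonneg hS fun l _ _ => Finset.prod_nonneg fun i _ => hg0 _
    _ = ∏ i, ∑ n ∈ t i, g (k i - n) := (Finset.prod_univ_sum t fun i n => g (k i - n)).symm
    _ ≤ ∏ _i : Fin d, ∑' n, g n := by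
        refine Finset.prod_le_prod (fun i _ => Finset.sum_nonneg fun n _ => hg0 _) fun i _ => ?_
        have h : Summable fun n => g (k i - n) := (Equiv.subLeft (k i)).summable_iff.2 hg
        exact (h.sum_le_tsum _ fun n _ => hg0 _).trans_eq ((Equiv.subLeft (k i)).tsum_eq g)
    _ = (∑' n, g n) ^ d := by simp

/-- Schur's test for a symmetric nonnegative kernel on a finite set. -/
lemma sum_sum_mul_le_of_symm {α : Type*} (S : Finset α) (u : α → ℝ) (A : α → α → ℝ)
    (hA : ∀ k l, 0 ≤ A k l) (hsymm : ∀ k l, A k l = A l k) {B : ℝ}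
    (hB : ∀ k, ∑ l ∈ S, A k l ≤ B) :
    ∑ k ∈ S, ∑ l ∈ S, u k * u l * A k l ≤ B * ∑ k ∈ S, u k ^ 2 := by
  have h1 : ∑ k ∈ S, ∑ l ∈ S, u k ^ 2 * A k l ≤ B * ∑ k ∈ S, u k ^ 2 := by
    rw [Finset.mul_sum]
    refine Finset.sum_le_sum fun k _ => ?_
    rw [← Finset.mul_sum, mul_comm B]
    exact mul_le_mul_of_nonneg_left (hB k) (sq_nonneg _)
  have h2 : ∑ k ∈ S, ∑ l ∈ S, u l ^ 2 * A k l = ∑ k ∈ S, ∑ l ∈ S, u k ^ 2 * A k l := by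
    rw [Finset.sum_comm]
    exact Finset.sum_congr rfl fun k _ => Finset.sum_congr rfl fun l _ => by rw [hsymm]
  have h3 : ∑ k ∈ S, ∑ l ∈ S, u k * u l * A k l ≤
      ∑ k ∈ S, ∑ l ∈ S, (u k ^ 2 * A k l + u l ^ 2 * A k l) / 2 := by
    refine Finset.sum_le_sum fun k _ => Finset.sum_le_sum fun l _ => ?_
    nlinarith [mul_nonneg (sq_nonneg (u k - u l)) (hA k l)]
  simp only [← Finset.sum_div, Finset.sum_add_distrib, h2] at h3
  linarith

/-- The exponential sum is bounded in `L²` with respect to a Gaussian weight. -/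
lemma integrable_and_integral_gaussian_weight_le {d : ℕ} {c₀ : ℝ} (hc₀ : 0 < c₀)
    (m : Fin d → ℝ) {L : Fin d → ℝ} (hL : ∀ i, 0 < L i) (ξ : (Fin d → ℤ) → Fin d → ℝ)
    (hξ : ∀ k l : Fin d → ℤ, ∀ i, c₀ * |(k i : ℝ) - (l i : ℝ)| / L i ≤ |ξ k i - ξ l i|)
    (S : Finset (Fin d → ℤ)) (c : (Fin d → ℤ) → ℂ) :
    Integrable (fun y : Fin d → ℝ => ‖∑ k ∈ S, c k * ce (∑ i, ξ k i * y i)‖ ^ 2 *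
        ∏ i, Real.exp (-Real.pi * ((y i - m i) / L i) ^ 2)) ∧
      ∫ y : Fin d → ℝ, ‖∑ k ∈ S, c k * ce (∑ i, ξ k i * y i)‖ ^ 2 *
        ∏ i, Real.exp (-Real.pi * ((y i - m i) / L i) ^ 2) ≤
      (∏ i, L i) * (∑' n : ℤ, Real.exp (-Real.pi * (c₀ * n) ^ 2)) ^ d * ∑ k ∈ S, ‖c k‖ ^ 2 := by
  set f : (Fin d → ℝ) → ℝ := fun y => ‖∑ k ∈ S, c k * ce (∑ i, ξ k i * y i)‖ ^ 2 *
        ∏ i, Real.exp (-Real.pi * ((y i - m i) / L i) ^ 2) with hf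
  have hexpand : (fun y => (f y : ℂ)) = fun y => ∑ k ∈ S, ∑ l ∈ S,
      c k * (starRingEnd ℂ) (c l) *
        ∏ i, modulatedGaussian (m i) (L i) (ξ k i - ξ l i) (y i) := by
    funext y
    simp only [hf, prod_modulatedGaussian]
    rw [Complex.ofReal_mul, Complex.ofReal_pow, ← Complex.mul_conj', map_sum, Finset.sum_mul_sum,
      Finset.sum_mul]
    refine Finset.sum_congr rfl fun k _ => ?_
    rw [Finset.sum_mul]
    refine Finset.sum_congr rfl fun l _ => ?_
    rw [map_mul]
    ring
  have hint : ∀ k l, Integrable fun y : Fin d → ℝ => c k * (starRingEnd ℂ) (c l) *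
      ∏ i, modulatedGaussian (m i) (L i) (ξ k i - ξ l i) (y i) := fun k l =>
    (Integrable.fintype_prod (f := fun i => modulatedGaussian (m i) (L i) (ξ k i - ξ l i))
      fun i => integrable_modulatedGaussian _ _ (hL i)).const_mul _
  have hfint : Integrable fun y => (f y : ℂ) := by
    rw [hexpand]
    exact integrable_finsetSum _ fun k _ => integrable_finsetSum _ fun l _ => hint k l
  refine ⟨by simpa using hfint.re, ?_⟩
  set A : (Fin d → ℤ) → (Fin d → ℤ) → ℝ := fun k l =>
    (∏ i, L i) * ∏ i, Real.exp (-Real.pi * (c₀ * ((k i - l i : ℤ) : ℝ)) ^ 2) with hAdef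
  have hLp : 0 ≤ ∏ i, L i := Finset.prod_nonneg fun i _ => (hL i).le
  have hkernel : ∀ k l, ‖∫ y : Fin d → ℝ, c k * (starRingEnd ℂ) (c l) *
      ∏ i, modulatedGaussian (m i) (L i) (ξ k i - ξ l i) (y i)‖ ≤ ‖c k‖ * ‖c l‖ * A k l := by
    intro k l
    rw [integral_const_mul, norm_mul, norm_mul, Complex.norm_conj,
      norm_integral_prod_modulatedGaussian m (fun i => ξ k i - ξ l i) hL]
    refine mul_le_mul_of_nonneg_left (mul_le_mul_of_nonneg_left ?_ hLp) (by positivity)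
    refine Finset.prod_le_prod (fun i _ => (Real.exp_pos _).le) fun i _ => Real.exp_le_exp.2 ?_
    have h1 : |c₀ * ((k i - l i : ℤ) : ℝ)| ≤ |L i * (ξ k i - ξ l i)| := by
      rw [abs_mul, abs_mul, abs_of_pos hc₀, abs_of_pos (hL i), mul_comm (L i)]
      push_cast
      exact (div_le_iff₀ (hL i)).1 (hξ k l i)
    have h2 := sq_le_sq.2 h1
    nlinarith [Real.pi_pos]
  have hnorm : ∫ y, f y ≤ ∑ k ∈ S, ∑ l ∈ S, ‖c k‖ * ‖c l‖ * A k l := by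
    calc ∫ y, f y ≤ ‖((∫ y, f y : ℝ) : ℂ)‖ := by
          rw [Complex.norm_real]; exact le_abs_self _
      _ = ‖∑ k ∈ S, ∑ l ∈ S, ∫ y : Fin d → ℝ, c k * (starRingEnd ℂ) (c l) *
            ∏ i, modulatedGaussian (m i) (L i) (ξ k i - ξ l i) (y i)‖ := by
          rw [← integral_complex_ofReal, hexpand, integral_finsetSum _ fun k _ =>
            integrable_finsetSum _ fun l _ => hint k l]
          congr 1
          exact Finset.sum_congr rfl fun k _ => integral_finsetSum _ fun l _ => hint k l
      _ ≤ _ := (norm_sum_le _ _).trans <| Finset.sum_le_sum fun k _ =>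
          (norm_sum_le _ _).trans <| Finset.sum_le_sum fun l _ => hkernel k l
  refine hnorm.trans (sum_sum_mul_le_of_symm S (fun k => ‖c k‖) A
    (fun k l => mul_nonneg hLp (Finset.prod_nonneg fun i _ => (Real.exp_pos _).le))
    (fun k l => ?_) fun k => ?_)
  · simp only [hAdef]
    congr 1
    refine Finset.prod_congr rfl fun i _ => ?_
    congr 1
    push_cast
    ring
  · rw [← Finset.mul_sum]
    exact mul_le_mul_of_nonneg_left (sum_prod_le_tsum_pow (summable_exp_neg_pi_mul_sq hc₀)
      (fun n => (Real.exp_pos _).le) S k) hLp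

lemma one_le_exp_mul_gaussian_of_mem_Icc {a b y : ℝ} (hab : a < b) (hy : y ∈ Set.Icc a b) :
    1 ≤ Real.exp Real.pi * Real.exp (-Real.pi * ((y - a) / (b - a)) ^ 2) := by
  rw [← Real.exp_add]
  refine Real.one_le_exp ?_
  have h0 : 0 < b - a := sub_pos.2 hab
  have h1 : 0 ≤ (y - a) / (b - a) := div_nonneg (sub_nonneg.2 hy.1) h0.le
  have h2 : (y - a) / (b - a) ≤ 1 := (div_le_one h0).2 (by linarith [hy.2])
  have h3 : ((y - a) / (b - a)) ^ 2 ≤ 1 := pow_le_one₀ h1 h2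
  nlinarith [Real.pi_pos]

/-- Almost orthogonality of separated frequencies: if `I = I₁ × ⋯ × I_d` is a product of
bounded intervals and the frequencies `ξ_k` satisfy `|ξ_{k,i} - ξ_{l,i}| ≥ c₀ |k_i - l_i|/|I_i|`,
then `‖∑_k c_k e(ξ_k ⬝ y)‖_{L²(I)} ≤ C |I|^{1/2} (∑_k |c_k|²)^{1/2}` with `C = C(c₀, d)`. -/
theorem exp_sum_almost_orthogonal (d : ℕ) (hd : 1 ≤ d) (c₀ : ℝ) (hc₀ : 0 < c₀) :
    ∃ C : ℝ≥0, ∀ (a b : Fin d → ℝ), (∀ i, a i < b i) →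
      ∀ ξ : (Fin d → ℤ) → (Fin d → ℝ),
      (∀ k l : Fin d → ℤ, ∀ i, c₀ * |(k i : ℝ) - (l i : ℝ)| / (b i - a i) ≤ |ξ k i - ξ l i|) →
      ∀ c : (Fin d → ℤ) →₀ ℂ,
      (∫⁻ y in Set.univ.pi (fun i => Set.Icc (a i) (b i)),
          (‖∑ k ∈ c.support, c k * ce (∑ i, ξ k i * y i)‖₊ : ℝ≥0∞) ^ (2 : ℝ)) ^ (1 / 2 : ℝ)
        ≤ C * (∏ i, ENNReal.ofReal (b i - a i)) ^ (1 / 2 : ℝ)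
            * (∑ k ∈ c.support, (‖c k‖₊ : ℝ≥0∞) ^ (2 : ℝ)) ^ (1 / 2 : ℝ) := by
  set M : ℝ := ∑' n : ℤ, Real.exp (-Real.pi * (c₀ * n) ^ 2)
  have hM : 0 ≤ M := tsum_nonneg fun n => (Real.exp_pos _).le
  set K : ℝ := Real.exp Real.pi ^ d * M ^ d with hK
  have hK0 : 0 ≤ K := by positivity
  refine ⟨K.toNNReal ^ (1 / 2 : ℝ), fun a b hab ξ hξ c => ?_⟩
  have hL : ∀ i, 0 < b i - a i := fun i => sub_pos.2 (hab i)
  obtain ⟨hint, hle⟩ := integrable_and_integral_gaussian_weight_le hc₀ a hL ξ hξ c.support c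
  have hsq : ∀ z : ℂ, (‖z‖₊ : ℝ≥0∞) ^ (2 : ℝ) = ENNReal.ofReal (‖z‖ ^ 2) := fun z => by
    rw [ENNReal.ofReal_pow (norm_nonneg _), ofReal_norm, ENNReal.rpow_two]
    rfl
  rw [ENNReal.coe_rpow_of_nonneg _ (by norm_num : (0 : ℝ) ≤ 1 / 2),
    ← ENNReal.mul_rpow_of_nonneg _ _ (by norm_num), ← ENNReal.mul_rpow_of_nonneg _ _ (by norm_num)]
  refine ENNReal.rpow_le_rpow ?_ (by norm_num)
  simp only [hsq]
  rw [← ENNReal.ofReal_prod_of_nonneg fun i _ => (hL i).le,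
    ← ENNReal.ofReal_sum_of_nonneg fun k _ => sq_nonneg _]
  change _ ≤ ENNReal.ofReal K * _ * _
  rw [← ENNReal.ofReal_mul hK0,
    ← ENNReal.ofReal_mul (mul_nonneg hK0 (Finset.prod_nonneg fun i _ => (hL i).le))]
  set f : (Fin d → ℝ) → ℝ := fun y => ‖∑ k ∈ c.support, c k * ce (∑ i, ξ k i * y i)‖ ^ 2 *
        ∏ i, Real.exp (-Real.pi * ((y i - a i) / (b i - a i)) ^ 2) with hf
  have hf0 : ∀ y, 0 ≤ f y := fun y =>
    mul_nonneg (sq_nonneg _) (Finset.prod_nonneg fun i _ => (Real.exp_pos _).le)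
  have hpt : ∀ y ∈ Set.univ.pi (fun i => Set.Icc (a i) (b i)),
      ENNReal.ofReal (‖∑ k ∈ c.support, c k * ce (∑ i, ξ k i * y i)‖ ^ 2) ≤
        ENNReal.ofReal (Real.exp Real.pi ^ d * f y) := by
    intro y hy
    refine ENNReal.ofReal_le_ofReal ?_
    have h1 : 1 ≤ ∏ i, (Real.exp Real.pi *
        Real.exp (-Real.pi * ((y i - a i) / (b i - a i)) ^ 2)) :=
      Finset.one_le_prod
        fun i _ => one_le_exp_mul_gaussian_of_mem_Icc (hab i) (hy i (Set.mem_univ i))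
    rw [Finset.prod_mul_distrib, Finset.prod_const, Finset.card_univ, Fintype.card_fin] at h1
    calc _ ≤ ‖∑ k ∈ c.support, c k * ce (∑ i, ξ k i * y i)‖ ^ 2 * _ :=
          le_mul_of_one_le_right (sq_nonneg _) h1
      _ = Real.exp Real.pi ^ d * f y := by simp only [hf]; ring
  calc _ ≤ ∫⁻ y in Set.univ.pi (fun i => Set.Icc (a i) (b i)),
          ENNReal.ofReal (Real.exp Real.pi ^ d * f y) :=
        setLIntegral_mono' (MeasurableSet.univ_pi fun i => measurableSet_Icc) hpt
    _ ≤ ∫⁻ y, ENNReal.ofReal (Real.exp Real.pi ^ d * f y) := setLIntegral_le_lintegral _ _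
    _ = ENNReal.ofReal (∫ y, Real.exp Real.pi ^ d * f y) :=
        (ofReal_integral_eq_lintegral_ofReal (hint.const_mul _) (Filter.Eventually.of_forall
          fun y => mul_nonneg (by positivity) (hf0 y))).symm
    _ ≤ _ := by
        refine ENNReal.ofReal_le_ofReal ?_
        rw [integral_const_mul]
        refine (mul_le_mul_of_nonneg_left hle (by positivity)).trans_eq ?_
        rw [hK]
        ring
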